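/- arXiv:2510.05999 — 3 statements merged into one kernel-verified Lean document; each statement's English description precedes it below -/
import Mathlib

section
/- Let $N\ge2$, $p>1$ and $\gamma>p-1$, and set $C_{p,\gamma}=\frac{\gamma-p+1}{p}$. Then for every $u\in C_c^\infty(\mathbb{R}^N)$ one has $C_{p,\gamma}^{\,p}\int_{\mathbb{R}^N_+}\frac{|u(x)|^p}{(1+x_N)^{p-\gamma}}\,dx+C_{p,\gamma}^{\,p-1}\int_{\mathbb{R}^{N-1}}|u(x',0)|^p\,dx'\;\le\;\int_{\mathbb{R}^N_+}(1+x_N)^{\gamma}|\nabla u(x)|^p\,dx$. -/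
open MeasureTheory Filter
open scoped Topology ENNReal

noncomputable section

/-- The last coordinate of a point of `ℝ^N`. -/
def xN (N : ℕ) (hN : 0 < N) (x : EuclideanSpace ℝ (Fin N)) : ℝ :=
  x ⟨N - 1, Nat.sub_lt hN Nat.one_pos⟩

/-- The open upper half-space `ℝ^N₊`. -/
def Hplus (N : ℕ) (hN : 0 < N) : Set (EuclideanSpace ℝ (Fin N)) :=
  {x | 0 < xN N hN x}

/-- The point `(y, t) ∈ ℝ^N` with horizontal part `y ∈ ℝ^(N-1)` and last coordinate `t`. -/
def mkPt (N : ℕ) (y : EuclideanSpace ℝ (Fin (N - 1))) (t : ℝ) :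
    EuclideanSpace ℝ (Fin N) :=
  (WithLp.equiv 2 (Fin N → ℝ)).symm fun i => if h : (i : ℕ) < N - 1 then y ⟨(i : ℕ), h⟩ else t

/-- The boundary point `(y, 0)`. -/
def bPt (N : ℕ) (y : EuclideanSpace ℝ (Fin (N - 1))) : EuclideanSpace ℝ (Fin N) :=
  mkPt N y 0

/-- Partial derivative of `u` in the `i`-th coordinate direction. -/
def pd (N : ℕ) (u : EuclideanSpace ℝ (Fin N) → ℝ) (i : Fin N)
    (x : EuclideanSpace ℝ (Fin N)) : ℝ :=
  fderiv ℝ u x (EuclideanSpace.single i 1)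

/-- `div (w ∇u)` written as a sum of coordinate partial derivatives. -/
def divW (N : ℕ) (w u : EuclideanSpace ℝ (Fin N) → ℝ)
    (x : EuclideanSpace ℝ (Fin N)) : ℝ :=
  ∑ i, pd N (fun z => w z * pd N u i z) i x


lemma aux_young (p γ C s a b : ℝ) (hp : 1 < p) (hC : 0 < C) (hs : 0 < s) :
    C ^ p * (|a| ^ p * s ^ (γ - p)) ≤
      s ^ γ * |b| ^ p + C ^ (p - 1) * (p * C * s ^ (γ - p) * |a| ^ p +
        s ^ (γ - p + 1) * (p * |a| ^ (p - 2) * a * b)) := by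
  have hp0 : 0 < p := by linarith
  have hpq : (p / (p - 1)).HolderConjugate p := by
    refine (Real.HolderConjugate.conjExponent hp).symm
  have hA : 0 ≤ C * |a| * s ^ ((γ - p) / p) := by positivity
  have hB : 0 ≤ s ^ (γ / p) * |b| := by positivity
  have Y := Real.young_inequality_of_nonneg (Real.rpow_nonneg hA (p - 1)) hB hpq
  have hp1 : p - 1 ≠ 0 := by linarith
  have e1 : ((C * |a| * s ^ ((γ - p) / p)) ^ (p - 1)) ^ (p / (p - 1))
      = C ^ p * |a| ^ p * s ^ (γ - p) := by
    rw [← Real.rpow_mul hA, mul_div_cancel₀ _ hp1, Real.mul_rpow (by positivity) (by positivity),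
      Real.mul_rpow hC.le (abs_nonneg _), ← Real.rpow_mul hs.le, div_mul_cancel₀ _ hp0.ne']
  have e2 : (s ^ (γ / p) * |b|) ^ p = s ^ γ * |b| ^ p := by
    rw [Real.mul_rpow (by positivity) (abs_nonneg _), ← Real.rpow_mul hs.le,
      div_mul_cancel₀ _ hp0.ne']
  have e3 : (C * |a| * s ^ ((γ - p) / p)) ^ (p - 1) * (s ^ (γ / p) * |b|)
      = C ^ (p - 1) * |a| ^ (p - 1) * s ^ (γ - p + 1) * |b| := by
    rw [Real.mul_rpow (by positivity) (by positivity), Real.mul_rpow hC.le (abs_nonneg _),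
      ← Real.rpow_mul hs.le]
    have : s ^ ((γ - p) / p * (p - 1)) * s ^ (γ / p) = s ^ (γ - p + 1) := by
      rw [← Real.rpow_add hs]; congr 1; field_simp; ring
    rw [← this]; ring
  rw [e1, e2, e3] at Y
  have e4 : |a| ^ (p - 2) * |a| = |a| ^ (p - 1) := by
    rcases eq_or_ne a 0 with rfl | ha
    · simp [Real.zero_rpow hp1]
    · rw [← Real.rpow_add_one (abs_pos.2 ha).ne']; congr 1; ring
  have e5 : -(|a| ^ (p - 1) * |b|) ≤ |a| ^ (p - 2) * a * b := by
    rw [← e4, mul_assoc, mul_assoc, ← abs_mul, ← mul_neg]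
    exact mul_le_mul_of_nonneg_left (neg_abs_le _) (by positivity)
  have e6 : C ^ p = C ^ (p - 1) * C := by
    rw [← Real.rpow_add_one hC.ne']; congr 1; ring
  have Y2 := mul_le_mul_of_nonneg_left Y hp0.le
  have e7 : p * (C ^ p * |a| ^ p * s ^ (γ - p) / (p / (p - 1)) + s ^ γ * |b| ^ p / p)
      = (p - 1) * (C ^ p * |a| ^ p * s ^ (γ - p)) + s ^ γ * |b| ^ p := by
    field_simp
  rw [e7] at Y2
  have e8 := mul_le_mul_of_nonneg_left e5
    (show 0 ≤ p * C ^ (p - 1) * s ^ (γ - p + 1) by positivity)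
  have e9 : C ^ (p - 1) * (p * C * s ^ (γ - p) * |a| ^ p +
        s ^ (γ - p + 1) * (p * |a| ^ (p - 2) * a * b))
      = p * (C ^ p * |a| ^ p * s ^ (γ - p)) +
        p * C ^ (p - 1) * s ^ (γ - p + 1) * (|a| ^ (p - 2) * a * b) := by
    rw [e6]; ring
  rw [e9]
  linarith

lemma aux_int (φ : ℝ → ℝ) (hφ : Continuous φ) (hc : HasCompactSupport φ) (e : ℝ) :
    IntegrableOn (fun t => (1 + t) ^ e * φ t) (Set.Ioi 0) := by
  have hcont : Continuous fun t : ℝ => (1 + max t 0) ^ e * φ t := by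
    refine Continuous.mul (Continuous.rpow_const (by fun_prop) fun t => Or.inl ?_) hφ
    have := le_max_right t 0
    positivity
  have h := (hcont.integrable_of_hasCompactSupport (μ := volume) hc.mul_left).integrableOn
    (s := Set.Ioi 0)
  refine h.congr_fun (fun t ht => ?_) measurableSet_Ioi
  have : max t 0 = t := max_eq_left (le_of_lt ht)
  simp only [this]

lemma aux_1d (p γ : ℝ) (hp : 1 < p) (hγ : p - 1 < γ) (f : ℝ → ℝ) (hf : ContDiff ℝ 1 f)
    (hc : HasCompactSupport f) :
    ((γ - p + 1) / p) ^ p * (∫ t in Set.Ioi (0 : ℝ), |f t| ^ p / (1 + t) ^ (p - γ)) +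
      ((γ - p + 1) / p) ^ (p - 1) * |f 0| ^ p ≤
      ∫ t in Set.Ioi (0 : ℝ), (1 + t) ^ γ * |deriv f t| ^ p := by
  have hp0 : 0 < p := by linarith
  set C := (γ - p + 1) / p with hCdef
  have hC : 0 < C := div_pos (by linarith) hp0
  have hpC : p * C = γ - p + 1 := by rw [hCdef]; field_simp
  set h : ℝ → ℝ := fun t => |f t| ^ p with hh
  have hh1 : ContDiff ℝ 1 h := by
    have := hf.norm_rpow hp
    simpa only [Real.norm_eq_abs] using this
  have hhd : ∀ t, HasDerivAt h (p * |f t| ^ (p - 2) * f t * deriv f t) t := fun t =>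
    (hasDerivAt_abs_rpow (f t) hp).comp t ((hf.differentiable one_ne_zero t).hasDerivAt)
  have hder : deriv h = fun t => p * |f t| ^ (p - 2) * f t * deriv f t :=
    funext fun t => (hhd t).deriv
  have hhc : HasCompactSupport h :=
    hc.comp_left (g := fun x : ℝ => |x| ^ p) (by simp [Real.zero_rpow hp0.ne'])
  have i1 := aux_int h hh1.continuous hhc (γ - p)
  have i2 := aux_int (deriv h) (hh1.continuous_deriv le_rfl) hhc.deriv (γ - p + 1)
  have hdc : HasCompactSupport fun t => |deriv f t| ^ p :=
    hc.deriv.comp_left (g := fun x : ℝ => |x| ^ p) (by simp [Real.zero_rpow hp0.ne'])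
  have i3 := aux_int (fun t => |deriv f t| ^ p)
    (((hf.continuous_deriv le_rfl).abs).rpow_const fun _ => Or.inr hp0.le) hdc γ
  have ftc : ∫ t in Set.Ioi (0 : ℝ), (p * C * ((1 + t) ^ (γ - p) * h t) +
      (1 + t) ^ (γ - p + 1) * deriv h t) = 0 - (1 + (0 : ℝ)) ^ (γ - p + 1) * h 0 := by
    refine integral_Ioi_of_hasDerivAt_of_tendsto'
      (f := fun t => (1 + t) ^ (γ - p + 1) * h t) (fun t ht => ?_) ((i1.const_mul _).add i2) ?_
    · have ht : (0 : ℝ) ≤ t := ht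
      have d1 : HasDerivAt (fun t : ℝ => (1 + t) ^ (γ - p + 1))
          (1 * (γ - p + 1) * (1 + t) ^ (γ - p + 1 - 1)) t :=
        ((hasDerivAt_id' t).const_add 1).rpow_const (Or.inl (by positivity))
      have d2 := d1.mul (hhd t).differentiableAt.hasDerivAt
      refine d2.congr_deriv ?_
      rw [hpC, add_sub_cancel_right]; ring
    · have : HasCompactSupport fun t : ℝ => (1 + t) ^ (γ - p + 1) * h t := hhc.mul_left
      have h0 := (hasCompactSupport_iff_eventuallyEq.1 this).filter_mono
        (show (atTop : Filter ℝ) ≤ coclosedCompact ℝ by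
          rw [coclosedCompact_eq_cocompact]; exact atTop_le_cocompact)
      exact tendsto_const_nhds.congr' h0.symm
  have key : ∫ t in Set.Ioi (0 : ℝ), C ^ p * ((1 + t) ^ (γ - p) * h t) ≤
      ∫ t in Set.Ioi (0 : ℝ), ((1 + t) ^ γ * |deriv f t| ^ p + C ^ (p - 1) *
        (p * C * ((1 + t) ^ (γ - p) * h t) + (1 + t) ^ (γ - p + 1) * deriv h t)) := by
    refine setIntegral_mono_on (i1.const_mul _)
      (i3.add (((i1.const_mul _).add i2).const_mul _)) measurableSet_Ioi fun t ht => ?_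
    have ht : (0 : ℝ) < t := ht
    have := aux_young p γ C (1 + t) (f t) (deriv f t) hp hC (by linarith)
    rw [hder]
    simp only [hh]
    linarith
  have i4 : IntegrableOn (fun t => C ^ (p - 1) * (p * C * ((1 + t) ^ (γ - p) * h t) +
      (1 + t) ^ (γ - p + 1) * deriv h t)) (Set.Ioi 0) := ((i1.const_mul _).add i2).const_mul _
  rw [integral_add i3 i4, integral_const_mul,
    integral_const_mul, ftc] at key
  have e : ∫ t in Set.Ioi (0 : ℝ), |f t| ^ p / (1 + t) ^ (p - γ) =
      ∫ t in Set.Ioi (0 : ℝ), (1 + t) ^ (γ - p) * h t := by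
    refine setIntegral_congr_fun measurableSet_Ioi fun t ht => ?_
    have ht : (0 : ℝ) < t := ht
    simp only [hh]
    rw [show γ - p = -(p - γ) by ring, Real.rpow_neg (by linarith)]
    ring
  rw [e]
  simp only [add_zero, Real.one_rpow, one_mul] at key
  simp only [hh] at key ⊢
  linarith

lemma mkPt_castSucc (n : ℕ) (y : EuclideanSpace ℝ (Fin n)) (t : ℝ) (i : Fin n) :
    mkPt (n + 1) y t i.castSucc = y i := by
  simp [mkPt]

lemma mkPt_last (n : ℕ) (y : EuclideanSpace ℝ (Fin n)) (t : ℝ) :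
    mkPt (n + 1) y t (Fin.last n) = t := by
  simp [mkPt]

lemma mkPt_norm (n : ℕ) (y : EuclideanSpace ℝ (Fin n)) (t : ℝ) :
    ‖mkPt (n + 1) y t‖ ^ 2 = ‖y‖ ^ 2 + t ^ 2 := by
  rw [EuclideanSpace.norm_sq_eq, Fin.sum_univ_castSucc, EuclideanSpace.norm_sq_eq]
  simp only [mkPt_castSucc, mkPt_last]
  simp

lemma mkPt_eq (n : ℕ) (y : EuclideanSpace ℝ (Fin n)) (t : ℝ) :
    mkPt (n + 1) y t = mkPt (n + 1) y 0 + t • EuclideanSpace.single (Fin.last n) (1 : ℝ) := by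
  ext i
  refine Fin.lastCases ?_ (fun i => ?_) i
  · simp [mkPt_last]
  · simp [mkPt_castSucc]

lemma mkPt_cont (n : ℕ) :
    Continuous fun z : EuclideanSpace ℝ (Fin n) × ℝ => mkPt (n + 1) z.1 z.2 := by
  unfold mkPt
  refine (PiLp.continuous_toLp 2 _).comp (continuous_pi fun i => ?_)
  split_ifs <;> fun_prop

/-- the coordinates equivalence -/
def qEquiv (n : ℕ) : EuclideanSpace ℝ (Fin n) × ℝ ≃ᵐ EuclideanSpace ℝ (Fin (n + 1)) :=
  (MeasurableEquiv.prodComm.trans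
    ((MeasurableEquiv.refl ℝ).prodCongr (MeasurableEquiv.toLp 2 (Fin n → ℝ)).symm)).trans
  ((MeasurableEquiv.piFinSuccAbove (fun _ => ℝ) (Fin.last n)).symm.trans
    (MeasurableEquiv.toLp 2 (Fin (n + 1) → ℝ)))

lemma qEquiv_apply (n : ℕ) (z : EuclideanSpace ℝ (Fin n) × ℝ) :
    qEquiv n z = mkPt (n + 1) z.1 z.2 := by
  ext i
  refine Fin.lastCases ?_ (fun i => ?_) i
  · rw [mkPt_last]
    simp [qEquiv, MeasurableEquiv.piFinSuccAbove, MeasurableEquiv.prodComm,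
      MeasurableEquiv.prodCongr]
  · rw [mkPt_castSucc]
    simp [qEquiv, MeasurableEquiv.piFinSuccAbove, MeasurableEquiv.prodComm,
      MeasurableEquiv.prodCongr]

lemma qEquiv_mp (n : ℕ) : MeasurePreserving (qEquiv n) (volume.prod volume) volume := by
  refine MeasurePreserving.trans (MeasurePreserving.trans (μb := volume.prod volume)
    Measure.measurePreserving_swap
    (μc := volume.prod volume) ?_) (MeasurePreserving.trans
      (volume_preserving_piFinSuccAbove (fun _ => ℝ) (Fin.last n)).symm
      (PiLp.volume_preserving_toLp _))
  exact (MeasurePreserving.id volume).prod (PiLp.volume_preserving_ofLp _)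

lemma aux_fubini (n : ℕ) (F : EuclideanSpace ℝ (Fin (n + 1)) → ℝ)
    (hF : IntegrableOn F (Hplus (n + 1) n.succ_pos)) :
    Integrable (fun y : EuclideanSpace ℝ (Fin n) =>
        ∫ t in Set.Ioi (0 : ℝ), F (mkPt (n + 1) y t)) ∧
      ∫ x in Hplus (n + 1) n.succ_pos, F x =
        ∫ y : EuclideanSpace ℝ (Fin n), ∫ t in Set.Ioi (0 : ℝ), F (mkPt (n + 1) y t) := by
  have hpre : (qEquiv n) ⁻¹' (Hplus (n + 1) n.succ_pos) = Set.univ ×ˢ Set.Ioi 0 := by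
    ext z
    have : xN (n + 1) n.succ_pos (mkPt (n + 1) z.1 z.2) = z.2 := mkPt_last n z.1 z.2
    simp [Hplus, qEquiv_apply, this]
  have h1 := (qEquiv_mp n).setIntegral_preimage_emb (qEquiv n).measurableEmbedding F
    (Hplus (n + 1) n.succ_pos)
  have h2 := ((qEquiv_mp n).integrableOn_comp_preimage (qEquiv n).measurableEmbedding).2 hF
  rw [hpre] at h1 h2
  have h3 := h2
  unfold IntegrableOn at h3
  rw [← Measure.prod_restrict, Measure.restrict_univ] at h3
  refine ⟨?_, ?_⟩
  · simpa only [Function.comp_def, qEquiv_apply] using h3.integral_prod_left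
  · rw [← h1]
    have := setIntegral_prod _ h2
    simpa only [Function.comp_def, qEquiv_apply, Measure.restrict_univ] using this

lemma aux_int2 (n : ℕ) (φ : EuclideanSpace ℝ (Fin (n + 1)) → ℝ) (hφ : Continuous φ)
    (hc : HasCompactSupport φ) (e : ℝ) :
    IntegrableOn (fun x => (1 + xN (n + 1) n.succ_pos x) ^ e * φ x)
      (Hplus (n + 1) n.succ_pos) := by
  have hx : Continuous (xN (n + 1) n.succ_pos) := by unfold xN; fun_prop
  have hcont : Continuous fun x => (1 + max (xN (n + 1) n.succ_pos x) 0) ^ e * φ x := by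
    refine Continuous.mul (Continuous.rpow_const (by fun_prop) fun t => Or.inl ?_) hφ
    have := le_max_right (xN (n + 1) n.succ_pos t) 0
    positivity
  have h := (hcont.integrable_of_hasCompactSupport (μ := volume) hc.mul_left).integrableOn
    (s := Hplus (n + 1) n.succ_pos)
  refine h.congr_fun (fun t ht => ?_) (measurableSet_lt measurable_const hx.measurable)
  have : max (xN (n + 1) n.succ_pos t) 0 = xN (n + 1) n.succ_pos t := max_eq_left (le_of_lt ht)
  simp only [this]

lemma aux_main (n : ℕ) (p γ : ℝ) (hp : 1 < p) (hγ : p - 1 < γ)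
    (u : EuclideanSpace ℝ (Fin (n + 1)) → ℝ)
    (hu : ContDiff ℝ 1 u) (hsupp : HasCompactSupport u) :
    ((γ - p + 1) / p) ^ p *
        (∫ x in Hplus (n + 1) n.succ_pos, |u x| ^ p / (1 + xN (n + 1) n.succ_pos x) ^ (p - γ)) +
      ((γ - p + 1) / p) ^ (p - 1) *
        (∫ y : EuclideanSpace ℝ (Fin n), |u (mkPt (n + 1) y 0)| ^ p) ≤
      ∫ x in Hplus (n + 1) n.succ_pos,
        (1 + xN (n + 1) n.succ_pos x) ^ γ * ‖gradient u x‖ ^ p := by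
  have hp0 : 0 < p := by linarith
  have hz : (0 : ℝ) ^ p = 0 := Real.zero_rpow hp0.ne'
  have hmeas : MeasurableSet (Hplus (n + 1) n.succ_pos) := by
    have hx : Continuous (xN (n + 1) n.succ_pos) := by unfold xN; fun_prop
    exact measurableSet_lt measurable_const hx.measurable
  have hxN : ∀ (y : EuclideanSpace ℝ (Fin n)) t,
      xN (n + 1) n.succ_pos (mkPt (n + 1) y t) = t := mkPt_last n
  obtain ⟨R, hR⟩ : ∃ R : ℝ, ∀ x, R < ‖x‖ → u x = 0 := by
    obtain ⟨R, hR⟩ := hsupp.isCompact.isBounded.subset_closedBall 0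
    refine ⟨R, fun x hx => ?_⟩
    by_contra hne
    have := hR (subset_tsupport u hne)
    rw [mem_closedBall_zero_iff] at this
    linarith
  have hgn : ∀ x, ‖gradient u x‖ = ‖fderiv ℝ u x‖ := fun x => by simp [gradient]
  -- integrability
  have I1 : IntegrableOn (fun x => |u x| ^ p / (1 + xN (n + 1) n.succ_pos x) ^ (p - γ))
      (Hplus (n + 1) n.succ_pos) := by
    have := aux_int2 n (fun x => |u x| ^ p)
      (hu.continuous.abs.rpow_const fun _ => Or.inr hp0.le)
      (hsupp.comp_left (g := fun x : ℝ => |x| ^ p) (by simp [hz])) (γ - p)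
    refine this.congr_fun (fun x hx => ?_) hmeas
    have hx : 0 < xN (n + 1) n.succ_pos x := hx
    simp only
    rw [show γ - p = -(p - γ) by ring, Real.rpow_neg (by linarith)]
    ring
  have I3 : IntegrableOn (fun x => (1 + xN (n + 1) n.succ_pos x) ^ γ * ‖gradient u x‖ ^ p)
      (Hplus (n + 1) n.succ_pos) := by
    simp only [hgn]
    exact aux_int2 n (fun x => ‖fderiv ℝ u x‖ ^ p)
      ((hu.continuous_fderiv one_ne_zero).norm.rpow_const fun _ => Or.inr hp0.le)
      ((hsupp.fderiv ℝ).comp_left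
        (g := fun x : EuclideanSpace ℝ (Fin (n + 1)) →L[ℝ] ℝ => ‖x‖ ^ p) (by simp [hz])) γ
  have hb : Continuous fun y : EuclideanSpace ℝ (Fin n) => mkPt (n + 1) y 0 :=
    (mkPt_cont n).comp (by fun_prop : Continuous fun y : EuclideanSpace ℝ (Fin n) => (y, (0 : ℝ)))
  have I2 : Integrable fun y : EuclideanSpace ℝ (Fin n) => |u (mkPt (n + 1) y 0)| ^ p := by
    refine Continuous.integrable_of_hasCompactSupport
      (((hu.continuous.comp hb).abs).rpow_const fun _ => Or.inr hp0.le) ?_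
    refine HasCompactSupport.intro (isCompact_closedBall 0 R) fun y hy => ?_
    have hy : R < ‖y‖ := by simpa using hy
    have := mkPt_norm n y 0
    have h2 : ‖mkPt (n + 1) y 0‖ = ‖y‖ := by
      rw [← sq_eq_sq₀ (norm_nonneg _) (norm_nonneg _), this]; ring
    rw [hR _ (h2 ▸ hy)]; simp [hz]
  obtain ⟨J1, E1⟩ := aux_fubini n _ I1
  obtain ⟨J3, E3⟩ := aux_fubini n _ I3
  rw [E1, E3, ← integral_const_mul, ← integral_const_mul,
    ← integral_add (J1.const_mul _) (I2.const_mul _)]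
  -- slices
  have hline : ∀ (y : EuclideanSpace ℝ (Fin n)) t, HasDerivAt (fun t => mkPt (n + 1) y t)
      (EuclideanSpace.single (Fin.last n) (1 : ℝ)) t := fun y t => by
    have h : (fun t => mkPt (n + 1) y t) = fun t =>
      mkPt (n + 1) y 0 + t • EuclideanSpace.single (Fin.last n) (1 : ℝ) := funext (mkPt_eq n y)
    rw [h]
    simpa using ((hasDerivAt_id t).smul_const
      (EuclideanSpace.single (Fin.last n) (1 : ℝ))).const_add (mkPt (n + 1) y 0)
  have hlineC : ∀ y : EuclideanSpace ℝ (Fin n), ContDiff ℝ 1 fun t => mkPt (n + 1) y t := by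
    intro y
    have h : (fun t => mkPt (n + 1) y t) = fun t =>
      mkPt (n + 1) y 0 + t • EuclideanSpace.single (Fin.last n) (1 : ℝ) := funext (mkPt_eq n y)
    rw [h]
    fun_prop
  have hder : ∀ (y : EuclideanSpace ℝ (Fin n)) t,
      |deriv (fun t => u (mkPt (n + 1) y t)) t| ≤ ‖gradient u (mkPt (n + 1) y t)‖ := by
    intro y t
    have h1 := ((hu.differentiable one_ne_zero (mkPt (n + 1) y t)).hasFDerivAt).comp_hasDerivAt t
      (hline y t)
    have h2 : deriv (fun t => u (mkPt (n + 1) y t)) t = _ := h1.deriv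
    rw [h2, hgn, ← Real.norm_eq_abs]
    refine (ContinuousLinearMap.le_opNorm _ _).trans ?_
    simp
  refine integral_mono ((J1.const_mul _).add (I2.const_mul _)) J3 fun y => ?_
  have hfc : HasCompactSupport fun t => u (mkPt (n + 1) y t) := by
    refine HasCompactSupport.intro (isCompact_Icc (a := -R) (b := R)) fun t ht => hR _ ?_
    have h1 : R < |t| := by
      by_contra hcon
      exact ht (abs_le.1 (not_lt.1 hcon))
    refine h1.trans_le ?_
    rw [← abs_norm (mkPt (n + 1) y t)]
    refine sq_le_sq.1 ?_
    rw [mkPt_norm]; nlinarith [sq_nonneg ‖y‖]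
  have hfC : ContDiff ℝ 1 fun t => u (mkPt (n + 1) y t) := hu.comp (hlineC y)
  have main := aux_1d p γ hp hγ _ hfC hfc
  simp only [hxN]
  refine main.trans ?_
  have hdc : HasCompactSupport fun t => |deriv (fun t => u (mkPt (n + 1) y t)) t| ^ p :=
    hfc.deriv.comp_left (g := fun x : ℝ => |x| ^ p) (by simp [hz])
  have hgc : HasCompactSupport fun t => ‖gradient u (mkPt (n + 1) y t)‖ ^ p := by
    refine HasCompactSupport.intro (isCompact_Icc (a := -R) (b := R)) fun t ht => ?_
    have h1 : R < |t| := by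
      by_contra hcon
      exact ht (abs_le.1 (not_lt.1 hcon))
    have h2 : R < ‖mkPt (n + 1) y t‖ := by
      refine h1.trans_le ?_
      rw [← abs_norm (mkPt (n + 1) y t)]
      refine sq_le_sq.1 ?_
      rw [mkPt_norm]; nlinarith [sq_nonneg ‖y‖]
    have h3 : u =ᶠ[𝓝 (mkPt (n + 1) y t)] fun _ => 0 := by
      filter_upwards [(isOpen_lt continuous_const continuous_norm).mem_nhds h2] with x hx
      exact hR x hx
    rw [hgn, h3.fderiv_eq]
    simp [hz]
  refine setIntegral_mono_on (aux_int _ (((hfC.continuous_deriv le_rfl).abs).rpow_const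
    fun _ => Or.inr hp0.le) hdc γ) (aux_int _ ?_ hgc γ) measurableSet_Ioi fun t ht => ?_
  · simp only [hgn]
    exact (((hu.continuous_fderiv one_ne_zero).comp (hlineC y).continuous).norm).rpow_const
      fun _ => Or.inr hp0.le
  · have ht : (0 : ℝ) < t := ht
    exact mul_le_mul_of_nonneg_left (Real.rpow_le_rpow (abs_nonneg _) (hder y t) hp0.le)
      (by positivity)

theorem stmt0 (N : ℕ) (hN : 2 ≤ N) (p γ : ℝ) (hp : 1 < p) (hγ : p - 1 < γ)
    (u : EuclideanSpace ℝ (Fin N) → ℝ)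
    (hu : ContDiff ℝ (⊤ : ℕ∞) u) (hsupp : HasCompactSupport u) :
    ((γ - p + 1) / p) ^ p *
        (∫ x in Hplus N (by omega), |u x| ^ p / (1 + xN N (by omega) x) ^ (p - γ)) +
      ((γ - p + 1) / p) ^ (p - 1) *
        (∫ y : EuclideanSpace ℝ (Fin (N - 1)), |u (bPt N y)| ^ p) ≤
      ∫ x in Hplus N (by omega), (1 + xN N (by omega) x) ^ γ * ‖gradient u x‖ ^ p := by
  obtain ⟨n, rfl⟩ : ∃ n, N = n + 1 := ⟨N - 1, by omega⟩
  exact aux_main n p γ hp hγ u (hu.of_le (by exact_mod_cast le_top)) hsupp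
end
end

section
/- Let $N\ge3$, $\gamma>1$, and let $\rho:[0,\infty)\to[0,\infty)$ be locally integrable with $(1+s)^{\gamma}\le\rho(s)$ for all $s\ge0$. Define $S_{2}=\inf\big\{\int_{\mathbb{R}^N_+}\rho(x_N)|\nabla u|^2\,dx : u\in C_c^\infty(\mathbb{R}^N),\ \int_{\mathbb{R}^{N-1}}u(x',0)^2\,dx'=1\big\}$. Then for every $u\in C_c^\infty(\mathbb{R}^N)$, $S_{2}\int_{\mathbb{R}^{N-1}}u(x',0)^2\,dx'\le\int_{\mathbb{R}^N_+}\rho(x_N)\Big(\frac{\partial u}{\partial x_N}(x)\Big)^2\,dx$. -/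
open MeasureTheory Filter
open scoped Topology ENNReal

noncomputable section

lemma aux_integrable (N : ℕ) (hN : 0 < N) (ρ : ℝ → ℝ)
    (hρloc : LocallyIntegrableOn ρ (Set.Ici (0 : ℝ)))
    (g : EuclideanSpace ℝ (Fin N) → ℝ) (hg : Continuous g) (hgs : HasCompactSupport g) :
    IntegrableOn (fun x => ρ (xN N hN x) * g x) (Hplus N hN) := by
  obtain ⟨R, hR⟩ := (Metric.isBounded_iff_subset_closedBall 0).1 hgs.isCompact.isBounded
  obtain ⟨C, hC⟩ := hg.bounded_above_of_compact_support hgs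
  set l : Fin N := ⟨N - 1, Nat.sub_lt hN Nat.one_pos⟩ with hl
  let f : Fin N → ℝ → ℝ := fun i =>
    if i = l then Set.indicator (Set.Ioc 0 R) ρ else Set.indicator (Set.Icc (-R) R) (fun _ => 1)
  have hf : ∀ i, Integrable (f i) := by
    intro i
    by_cases h : i = l
    · simp only [f, h, if_true]
      rw [integrable_indicator_iff measurableSet_Ioc]
      exact (hρloc.integrableOn_compact_subset Set.Icc_subset_Ici_self
        (isCompact_Icc (a := (0:ℝ)) (b := R))).mono_set Set.Ioc_subset_Icc_self
    · simp only [f, h, if_false]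
      rw [integrable_indicator_iff measurableSet_Icc]
      exact (continuous_const.integrableOn_Icc)
  have h1 : Integrable (fun x : Fin N → ℝ => ∏ i, f i (x i)) := Integrable.fintype_prod hf
  have h2 : Integrable (fun x : EuclideanSpace ℝ (Fin N) => ∏ i, f i (x i)) :=
    ((EuclideanSpace.volume_preserving_symm_measurableEquiv_toLp (Fin N)).integrable_comp_emb
      (MeasurableEquiv.measurableEmbedding _)).2 h1
  have hm : MeasurableSet (Hplus N hN) := by
    apply IsOpen.measurableSet
    unfold Hplus xN
    exact isOpen_lt continuous_const (by fun_prop)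
  rw [← integrable_indicator_iff hm]
  refine (h2.mul_bdd (c := C) hg.aestronglyMeasurable (Eventually.of_forall hC)).congr
    (Eventually.of_forall fun x => ?_)
  beta_reduce
  by_cases hx : g x = 0
  · by_cases hH : x ∈ Hplus N hN <;> simp [hH, hx]
  have hxR : ‖x‖ ≤ R := by
    have := hR (subset_tsupport g hx)
    simpa using this
  have hc : ∀ i, |x i| ≤ R := fun i => (PiLp.norm_apply_le x i).trans hxR
  have hprod : ∏ i, f i (x i) = f l (x l) := by
    refine Finset.prod_eq_single l ?_ (by simp)
    intro i _ hi
    simp only [f, hi, if_false]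
    rw [Set.indicator_of_mem]
    exact abs_le.1 (hc i)
  rw [hprod]
  simp only [f, if_true, Hplus, Set.mem_setOf_eq, xN, Set.indicator_apply, Set.mem_Ioc, ← hl]
  have := (abs_le.1 (hc l)).2
  by_cases h0 : 0 < x l <;> simp [h0, this]

/-- the tangential dilation -/
def dil (N : ℕ) (hN : 0 < N) (t : ℝ) :
    EuclideanSpace ℝ (Fin N) →ₗ[ℝ] EuclideanSpace ℝ (Fin N) :=
  Matrix.toLin (EuclideanSpace.basisFun (Fin N) ℝ).toBasis (EuclideanSpace.basisFun (Fin N) ℝ).toBasis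
    (Matrix.diagonal fun i => if i = ⟨N - 1, Nat.sub_lt hN Nat.one_pos⟩ then 1 else t)

lemma dil_apply (N : ℕ) (hN : 0 < N) (t : ℝ) (x : EuclideanSpace ℝ (Fin N)) (i : Fin N) :
    dil N hN t x i = (if i = ⟨N - 1, Nat.sub_lt hN Nat.one_pos⟩ then 1 else t) * x i := by
  unfold dil
  rw [Matrix.toLin_apply]
  simp only [Matrix.mulVec_diagonal, WithLp.ofLp_sum, Finset.sum_apply, WithLp.ofLp_smul,
    Pi.smul_apply, OrthonormalBasis.coe_toBasis, EuclideanSpace.basisFun_apply,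
    OrthonormalBasis.coe_toBasis_repr_apply, EuclideanSpace.basisFun_repr, smul_eq_mul]
  rw [Finset.sum_eq_single i]
  · simp
  · intro j _ hj
    simp [hj.symm]
  · simp

lemma dil_det (N : ℕ) (hN : 0 < N) (t : ℝ) : LinearMap.det (dil N hN t) = t ^ (N - 1) := by
  unfold dil
  rw [LinearMap.det_toLin, Matrix.det_diagonal, Finset.prod_ite]
  simp [Finset.filter_ne']

lemma dil_integral (N : ℕ) (hN : 0 < N) (t : ℝ) (ht : 0 < t)
    (F : EuclideanSpace ℝ (Fin N) → ℝ) :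
    ∫ x in Hplus N hN, F (dil N hN t x) = (t ^ (N - 1))⁻¹ * ∫ x in Hplus N hN, F x := by
  have hd : LinearMap.det (dil N hN t) ≠ 0 := by rw [dil_det]; positivity
  have hm : MeasurableSet (Hplus N hN) := by
    apply IsOpen.measurableSet
    unfold Hplus xN
    exact isOpen_lt continuous_const (by fun_prop)
  let e := (LinearMap.equivOfDetNeZero _ hd).toContinuousLinearEquiv
  have he : ∀ x, e x = dil N hN t x := fun x => rfl
  have hmap := Measure.map_linearMap_addHaar_eq_smul_addHaar
    (volume : Measure (EuclideanSpace ℝ (Fin N))) hd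
  rw [← integral_indicator hm, ← integral_indicator hm]
  have h1 : ∀ x, (Hplus N hN).indicator (fun x => F (dil N hN t x)) x
      = (Hplus N hN).indicator F (e x) := by
    intro x
    simp only [Set.indicator_apply, he, Hplus, Set.mem_setOf_eq, xN, dil_apply, if_true, one_mul]
  simp_rw [h1]
  have h2 := (e.toHomeomorph.measurableEmbedding).integral_map
    (μ := (volume : Measure (EuclideanSpace ℝ (Fin N)))) ((Hplus N hN).indicator F)
  have h3 : (volume : Measure (EuclideanSpace ℝ (Fin N))).map e.toHomeomorph
    = (volume : Measure (EuclideanSpace ℝ (Fin N))).map (dil N hN t) := rfl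
  rw [h3, hmap, integral_smul_measure, dil_det, ENNReal.toReal_ofReal (abs_nonneg _),
    abs_of_pos (by positivity)] at h2
  exact h2.symm

lemma grad_sq (N : ℕ) (u : EuclideanSpace ℝ (Fin N) → ℝ) (x : EuclideanSpace ℝ (Fin N)) :
    ‖gradient u x‖ ^ 2 = ∑ i, (pd N u i x) ^ 2 := by
  rw [EuclideanSpace.norm_sq_eq]
  refine Finset.sum_congr rfl fun i _ => ?_
  have : pd N u i x = gradient u x i := by
    unfold pd gradient
    rw [← InnerProductSpace.toDual_symm_apply (𝕜 := ℝ), EuclideanSpace.inner_single_right]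
    simp
  rw [this, Real.norm_eq_abs, sq_abs]

lemma pd_dil (N : ℕ) (hN : 0 < N) (t c : ℝ) (u : EuclideanSpace ℝ (Fin N) → ℝ)
    (hu : Differentiable ℝ u) (i : Fin N) (x : EuclideanSpace ℝ (Fin N)) :
    pd N (fun x => c * u (dil N hN t x)) i x =
      c * ((if i = ⟨N - 1, Nat.sub_lt hN Nat.one_pos⟩ then 1 else t) * pd N u i (dil N hN t x)) := by
  unfold pd
  have h1 : HasFDerivAt (dil N hN t) (dil N hN t).toContinuousLinearMap x :=
    (dil N hN t).toContinuousLinearMap.hasFDerivAt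
  have h2 := ((hu (dil N hN t x)).hasFDerivAt.comp x h1).const_mul c
  have h3 : dil N hN t (EuclideanSpace.single i 1) =
      (if i = ⟨N - 1, Nat.sub_lt hN Nat.one_pos⟩ then (1:ℝ) else t) • EuclideanSpace.single i 1 := by
    ext j
    rw [dil_apply]
    by_cases h : j = i
    · subst h; split_ifs <;> simp
    · split_ifs <;> simp [h]
  have h4 : fderiv ℝ (fun x => c * u (dil N hN t x)) x = _ := h2.fderiv
  rw [h4]
  simp only [ContinuousLinearMap.smul_apply, ContinuousLinearMap.comp_apply,
    LinearMap.coe_toContinuousLinearMap', h3, map_smul, smul_eq_mul]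

lemma dil_bPt (N : ℕ) (hN : 0 < N) (t : ℝ) (y : EuclideanSpace ℝ (Fin (N - 1))) :
    dil N hN t (bPt N y) = bPt N (t • y) := by
  ext i
  rw [dil_apply]
  unfold bPt mkPt
  by_cases h : (i : ℕ) < N - 1
  · have : i ≠ ⟨N - 1, Nat.sub_lt hN Nat.one_pos⟩ := by
      intro h'; rw [h'] at h; simp at h
    simp [h, this]
  · simp [h]

theorem stmt5 (N : ℕ) (hN : 3 ≤ N) (γ : ℝ) (hγ : 1 < γ)
    (ρ : ℝ → ℝ) (hρloc : LocallyIntegrableOn ρ (Set.Ici (0 : ℝ)))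
    (hρnn : ∀ s : ℝ, 0 ≤ s → 0 ≤ ρ s)
    (hρ : ∀ s : ℝ, 0 ≤ s → (1 + s) ^ γ ≤ ρ s) :
    ∀ u : EuclideanSpace ℝ (Fin N) → ℝ,
      ContDiff ℝ (⊤ : ℕ∞) u → HasCompactSupport u →
      sInf {E : ℝ | ∃ v : EuclideanSpace ℝ (Fin N) → ℝ,
          ContDiff ℝ (⊤ : ℕ∞) v ∧ HasCompactSupport v ∧
          (∫ y : EuclideanSpace ℝ (Fin (N - 1)), (v (bPt N y)) ^ 2) = 1 ∧
          E = ∫ x in Hplus N (by omega),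
            ρ (xN N (by omega) x) * ‖gradient v x‖ ^ 2} *
        (∫ y : EuclideanSpace ℝ (Fin (N - 1)), (u (bPt N y)) ^ 2) ≤
      ∫ x in Hplus N (by omega),
        ρ (xN N (by omega) x) * (pd N u ⟨N - 1, by omega⟩ x) ^ 2 := by
  intro u hu hus
  have hN0 : 0 < N := by omega
  have hm : MeasurableSet (Hplus N hN0) := by
    apply IsOpen.measurableSet
    unfold Hplus xN
    exact isOpen_lt continuous_const (by fun_prop)
  set S := {E : ℝ | ∃ v : EuclideanSpace ℝ (Fin N) → ℝ,
          ContDiff ℝ (⊤ : ℕ∞) v ∧ HasCompactSupport v ∧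
          (∫ y : EuclideanSpace ℝ (Fin (N - 1)), (v (bPt N y)) ^ 2) = 1 ∧
          E = ∫ x in Hplus N (by omega),
            ρ (xN N (by omega) x) * ‖gradient v x‖ ^ 2} with hS
  set B := ∫ y : EuclideanSpace ℝ (Fin (N - 1)), (u (bPt N y)) ^ 2 with hB
  set P := ∫ x in Hplus N hN0, ρ (xN N hN0 x) * (pd N u ⟨N - 1, by omega⟩ x) ^ 2 with hP
  set A := ∫ x in Hplus N hN0, ρ (xN N hN0 x) * ‖gradient u x‖ ^ 2 with hA
  have hB0 : 0 ≤ B := integral_nonneg fun y => sq_nonneg _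
  have hP0 : 0 ≤ P := setIntegral_nonneg hm fun x hx =>
    mul_nonneg (hρnn _ (le_of_lt hx)) (sq_nonneg _)
  have hSb : BddBelow S := by
    refine ⟨0, ?_⟩
    rintro E ⟨v, _, _, _, rfl⟩
    exact setIntegral_nonneg hm fun x hx => mul_nonneg (hρnn _ (le_of_lt hx)) (sq_nonneg _)
  rcases hB0.eq_or_lt with h | hBpos
  · rw [← h, mul_zero]; exact hP0
  have hfc : Continuous (fderiv ℝ u) := hu.continuous_fderiv (by simp)
  have hpdc : ∀ i, Continuous (pd N u i) := fun i => by
    unfold pd; fun_prop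
  have hpds : ∀ i, HasCompactSupport (pd N u i) := fun i =>
    hus.fderiv_apply (𝕜 := ℝ) _
  have hIi : ∀ i, IntegrableOn (fun x => ρ (xN N hN0 x) * (pd N u i x) ^ 2) (Hplus N hN0) :=
    fun i => aux_integrable N hN0 ρ hρloc _ ((hpdc i).pow 2)
      ((hpds i).comp_left (g := fun z : ℝ => z ^ 2) (by simp))
  have hIA : IntegrableOn (fun x => ρ (xN N hN0 x) * ‖gradient u x‖ ^ 2) (Hplus N hN0) := by
    simp_rw [grad_sq, Finset.mul_sum]
    exact integrable_finsetSum _ fun i _ => hIi i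
  have key : ∀ t : ℝ, 0 < t → sInf S * B ≤ P + t ^ 2 * (A - P) := by
    intro t ht
    have htp : 0 < t ^ (N - 1) := by positivity
    set c := Real.sqrt (t ^ (N - 1) / B) with hc
    have hc2 : c ^ 2 = t ^ (N - 1) / B := Real.sq_sqrt (by positivity)
    have hmem : (P + t ^ 2 * (A - P)) / B ∈ S := by
      refine ⟨fun x => c * u (dil N hN0 t x), ?_, ?_, ?_, ?_⟩
      · exact contDiff_const.mul (hu.comp (dil N hN0 t).toContinuousLinearMap.contDiff)
      · have hd : LinearMap.det (dil N hN0 t) ≠ 0 := by rw [dil_det]; positivity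
        let e := (LinearMap.equivOfDetNeZero _ hd).toContinuousLinearEquiv
        have h1 : HasCompactSupport (fun x => u (dil N hN0 t x)) :=
          hus.comp_homeomorph e.toHomeomorph
        exact h1.mul_left
      · simp_rw [dil_bPt, mul_pow]
        rw [integral_const_mul,
          Measure.integral_comp_smul volume (fun y => (u (bPt N y)) ^ 2) t, ← hB, hc2]
        simp only [finrank_euclideanSpace, Fintype.card_fin, smul_eq_mul]
        rw [abs_of_pos (by positivity)]
        field_simp
      · have hG : ∀ x, ρ (xN N hN0 x) * ‖gradient (fun x => c * u (dil N hN0 t x)) x‖ ^ 2 =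
            (fun z => c ^ 2 * (t ^ 2 * (ρ (xN N hN0 z) * ‖gradient u z‖ ^ 2) + (1 - t ^ 2) *
              (ρ (xN N hN0 z) * (pd N u ⟨N - 1, by omega⟩ z) ^ 2))) (dil N hN0 t x) := by
          intro x
          have hx : xN N hN0 (dil N hN0 t x) = xN N hN0 x := by
            unfold xN; rw [dil_apply]; simp
          simp only [hx, grad_sq, pd_dil N hN0 t c u (hu.differentiable (by simp))]
          have hs : ∀ i, (c * ((if i = (⟨N - 1, Nat.sub_lt hN0 Nat.one_pos⟩ : Fin N) then 1 else t) *
              pd N u i (dil N hN0 t x))) ^ 2 = c ^ 2 * (t ^ 2 * pd N u i (dil N hN0 t x) ^ 2 +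
              if i = (⟨N - 1, Nat.sub_lt hN0 Nat.one_pos⟩ : Fin N) then
                (1 - t ^ 2) * pd N u i (dil N hN0 t x) ^ 2 else 0) := by
            intro i
            split_ifs <;> ring
          simp_rw [hs]
          rw [← Finset.mul_sum, Finset.sum_add_distrib, ← Finset.mul_sum, Finset.sum_ite_eq']
          simp only [Finset.mem_univ, if_true]
          ring
        simp_rw [hG]
        rw [dil_integral N hN0 t ht (fun z => c ^ 2 * (t ^ 2 * (ρ (xN N hN0 z) * ‖gradient u z‖ ^ 2) + (1 - t ^ 2) *
              (ρ (xN N hN0 z) * (pd N u ⟨N - 1, by omega⟩ z) ^ 2))), integral_const_mul,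
          integral_add (hIA.const_mul _) ((hIi _).const_mul _), integral_const_mul,
          integral_const_mul, ← hA, ← hP, hc2]
        field_simp
        ring
    have := csInf_le hSb hmem
    rwa [le_div_iff₀ hBpos] at this
  have hlim : Tendsto (fun t : ℝ => P + t ^ 2 * (A - P)) (𝓝[>] 0) (𝓝 P) := by
    have : Continuous (fun t : ℝ => P + t ^ 2 * (A - P)) := by fun_prop
    have h := this.tendsto 0
    simp only [ne_eq, OfNat.ofNat_ne_zero, not_false_eq_true, zero_pow, zero_mul, add_zero] at h
    exact h.mono_left nhdsWithin_le_nhds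
  refine ge_of_tendsto hlim ?_
  filter_upwards [self_mem_nhdsWithin] with t ht
  exact key t ht
end
end

section
/- Let $N\ge3$, $\gamma>1$, and let $\rho:[0,\infty)\to[0,\infty)$ be locally integrable with $(1+s)^{\gamma}\le\rho(s)$ for all $s\ge0$. Define $S_{2}=\inf\big\{\int_{\mathbb{R}^N_+}\rho(x_N)|\nabla u|^2\,dx : u\in C_c^\infty(\mathbb{R}^N),\ \int_{\mathbb{R}^{N-1}}u(x',0)^2\,dx'=1\big\}$. Then for every $u\in C_c^\infty(\mathbb{R}^N)$ whose boundary trace $x'\mapsto u(x',0)$ is not identically zero, the strict inequality $S_{2}\int_{\mathbb{R}^{N-1}}u(x',0)^2\,dx'<\int_{\mathbb{R}^N_+}\rho(x_N)|\nabla u|^2\,dx$ holds; in particular $S_{2}$ is not attained by any such function. -/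
open MeasureTheory Filter
open scoped Topology ENNReal

noncomputable section

/-- Scaling factors: halve the first coordinate only. -/
def dd (n : ℕ) (i : Fin n) : ℝ := if (i : ℕ) = 0 then 1 / 2 else 1

/-- The linear map halving the first coordinate. -/
def LL (n : ℕ) : EuclideanSpace ℝ (Fin n) →L[ℝ] EuclideanSpace ℝ (Fin n) :=
  Matrix.toEuclideanCLM (n := Fin n) (𝕜 := ℝ) (Matrix.diagonal (dd n))

lemma LL_apply (n : ℕ) (x : EuclideanSpace ℝ (Fin n)) (i : Fin n) : LL n x i = dd n i * x i := by
  unfold LL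
  rw [Matrix.ofLp_toEuclideanCLM, Matrix.mulVec_diagonal]

lemma dd_prod (n : ℕ) (hn : 0 < n) : ∏ i, dd n i = 1 / 2 := by
  obtain ⟨m, rfl⟩ : ∃ m, n = m + 1 := ⟨n - 1, by omega⟩
  rw [Fin.prod_univ_succ]
  simp [dd]

lemma LL_det (n : ℕ) (hn : 0 < n) :
    LinearMap.det (LL n : EuclideanSpace ℝ (Fin n) →ₗ[ℝ] EuclideanSpace ℝ (Fin n)) = 1 / 2 := by
  have : (LL n : EuclideanSpace ℝ (Fin n) →ₗ[ℝ] EuclideanSpace ℝ (Fin n))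
      = Matrix.toLpLin 2 2 (Matrix.diagonal (dd n)) := by
    rfl
  rw [this, LinearMap.det_toLpLin, Matrix.det_diagonal, dd_prod n hn]

/-- `LL` as a continuous linear equivalence. -/
def LLe (n : ℕ) (hn : 0 < n) : EuclideanSpace ℝ (Fin n) ≃L[ℝ] EuclideanSpace ℝ (Fin n) :=
  (LinearMap.equivOfDetNeZero _ (by rw [LL_det n hn]; norm_num :
    LinearMap.det (LL n : EuclideanSpace ℝ (Fin n) →ₗ[ℝ] EuclideanSpace ℝ (Fin n)) ≠ 0)).toContinuousLinearEquiv

lemma LLe_apply (n : ℕ) (hn : 0 < n) (x) : LLe n hn x = LL n x := rfl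

lemma integral_comp_LL (n : ℕ) (hn : 0 < n) (f : EuclideanSpace ℝ (Fin n) → ℝ) :
    ∫ x, f (LL n x) = 2 * ∫ x, f x := by
  have h := Measure.map_linearMap_addHaar_eq_smul_addHaar
    (volume : Measure (EuclideanSpace ℝ (Fin n)))
    (f := (LL n : EuclideanSpace ℝ (Fin n) →ₗ[ℝ] EuclideanSpace ℝ (Fin n)))
    (by rw [LL_det n hn]; norm_num)
  rw [LL_det n hn] at h
  have h2 : ∫ x, f x ∂(Measure.map (LL n) volume) = ∫ x, f (LL n x) :=
    (LLe n hn).toHomeomorph.measurableEmbedding.integral_map f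
  rw [← h2]
  have h3 : Measure.map (LL n) volume = ENNReal.ofReal |((1:ℝ) / 2)⁻¹| •
    (volume : Measure (EuclideanSpace ℝ (Fin n))) := h
  rw [h3, integral_smul_measure]
  norm_num

lemma pd_comp (N : ℕ) (u : EuclideanSpace ℝ (Fin N) → ℝ) (hu : Differentiable ℝ u) (a : ℝ)
    (i : Fin N) (x) :
    pd N (fun x => a * u (LL N x)) i x = a * (dd N i * pd N u i (LL N x)) := by
  have h1 : HasFDerivAt (fun x => u (LL N x)) ((fderiv ℝ u (LL N x)).comp (LL N)) x :=
    (hu (LL N x)).hasFDerivAt.comp x (LL N).hasFDerivAt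
  have h2 := h1.const_mul a
  unfold pd
  rw [h2.fderiv]
  have h3 : LL N (EuclideanSpace.single i 1) = dd N i • EuclideanSpace.single i (1:ℝ) := by
    ext j
    rw [LL_apply]
    by_cases h : j = i
    · subst h; simp
    · simp [h]
  simp [h3]

lemma norm_grad (N : ℕ) (u : EuclideanSpace ℝ (Fin N) → ℝ) (x) :
    ‖gradient u x‖ ^ 2 = ∑ i, (pd N u i x) ^ 2 := by
  rw [EuclideanSpace.norm_sq_eq]
  refine Finset.sum_congr rfl fun i _ => ?_
  rw [Real.norm_eq_abs, sq_abs]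
  congr 1
  unfold pd
  rw [← inner_gradient_left, EuclideanSpace.inner_single_right]
  simp

lemma bPt_LL (N : ℕ) (hN : 3 ≤ N) (y) : bPt N (LL (N - 1) y) = LL N (bPt N y) := by
  ext i
  rw [LL_apply]
  simp only [bPt, mkPt, WithLp.equiv_symm_apply]
  split_ifs with h
  · rw [LL_apply]; rfl
  · simp

lemma xN_LL (N : ℕ) (hN : 3 ≤ N) (h) (x) : xN N h (LL N x) = xN N h x := by
  unfold xN
  rw [LL_apply]
  have : N - 1 ≠ 0 := by omega
  simp [dd, this]

lemma xN_cont (N : ℕ) (h) : Continuous (xN N h) := by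
  unfold xN; fun_prop

lemma mkPt_cont_s6 (N : ℕ) : Continuous (fun p : EuclideanSpace ℝ (Fin (N-1)) × ℝ => mkPt N p.1 p.2) := by
  unfold mkPt
  refine (PiLp.continuous_toLp 2 _).comp ?_
  refine continuous_pi fun i => ?_
  split_ifs with h <;> fun_prop

lemma integ (N : ℕ) (h0 : 0 < N) (ρ : ℝ → ℝ) (hρloc : LocallyIntegrableOn ρ (Set.Ici (0 : ℝ)))
    (k : EuclideanSpace ℝ (Fin N) → ℝ) (hk : Continuous k) (hkc : HasCompactSupport k) :
    IntegrableOn (fun x => ρ (xN N h0 x) * k x) (Hplus N h0) := by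
  obtain ⟨C, hC⟩ := hkc.exists_bound_of_continuous hk
  obtain ⟨R, hR⟩ := hkc.isCompact.isBounded.subset_closedBall 0
  set l : Fin N := ⟨N - 1, Nat.sub_lt h0 Nat.one_pos⟩ with hl
  let f : Fin N → ℝ → ℝ := fun i => if i = l then (Set.Icc 0 R).indicator ρ
    else (Set.Icc (-R) R).indicator 1
  have hf : ∀ i, Integrable (f i) volume := by
    intro i
    by_cases h : i = l
    · simp only [f, h, if_true]
      rw [integrable_indicator_iff measurableSet_Icc]
      exact hρloc.integrableOn_compact_subset Set.Icc_subset_Ici_self isCompact_Icc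
    · simp only [f, h, if_false]
      rw [integrable_indicator_iff measurableSet_Icc]
      exact integrableOn_const (by simp)
  have hF : Integrable (fun x : Fin N → ℝ => ∏ i, f i (x i)) volume := Integrable.fintype_prod hf
  have hF2 : Integrable (fun x : EuclideanSpace ℝ (Fin N) => ∏ i, f i (x i)) volume :=
    (PiLp.volume_preserving_ofLp (Fin N)).integrable_comp_of_integrable hF
  have hF3 := hF2.mul_bdd hk.aestronglyMeasurable (ae_of_all _ hC)
  refine hF3.integrableOn.congr_fun ?_ (measurableSet_lt measurable_const (xN_cont N h0).measurable)
  intro x hx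
  by_cases hx0 : k x = 0
  · simp [hx0]
  have hxR : ‖x‖ ≤ R := by
    have := hR (subset_tsupport k (Function.mem_support.2 hx0))
    simpa using this
  have hxi : ∀ i, |x i| ≤ R := fun i => by
    have := PiLp.norm_apply_le x i
    rw [Real.norm_eq_abs] at this
    linarith
  simp only
  congr 1
  rw [Finset.prod_eq_single l]
  · have : x l ∈ Set.Icc 0 R := ⟨le_of_lt hx, (abs_le.1 (hxi l)).2⟩
    simp only [f, if_true]
    rw [Set.indicator_of_mem this]
    rfl
  · intro i _ hi
    simp only [f, hi, if_false]
    have hm : x i ∈ Set.Icc (-R) R := abs_le.1 (hxi i)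
    rw [Set.indicator_of_mem hm]
    rfl
  · simp

lemma pd_cont (N : ℕ) (u : EuclideanSpace ℝ (Fin N) → ℝ) (hu : ContDiff ℝ (⊤ : ℕ∞) u) (i) :
    Continuous (pd N u i) := by
  unfold pd
  exact (hu.continuous_fderiv (by simp)).clm_apply continuous_const

lemma pd_supp (N : ℕ) (u : EuclideanSpace ℝ (Fin N) → ℝ) (hu : HasCompactSupport u) (i) :
    HasCompactSupport (pd N u i) := by
  unfold pd
  exact hu.fderiv_apply ℝ _

/-- A point in the half-space where the first partial derivative is nonzero. -/
lemma exists_pd_ne (N : ℕ) (hN : 3 ≤ N) (h0 : 0 < N) (u : EuclideanSpace ℝ (Fin N) → ℝ)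
    (hu : ContDiff ℝ (⊤ : ℕ∞) u) (hc : HasCompactSupport u) (y) (hy : u (bPt N y) ≠ 0) :
    ∃ x ∈ Hplus N h0, pd N u ⟨0, h0⟩ x ≠ 0 := by
  have hcont : Continuous (fun t : ℝ => u (mkPt N y t)) :=
    hu.continuous.comp ((mkPt_cont_s6 N).comp (by fun_prop : Continuous fun t : ℝ => (y, t)))
  have hev : ∀ᶠ t in 𝓝 (0:ℝ), u (mkPt N y t) ≠ 0 := hcont.continuousAt.eventually_ne hy
  obtain ⟨t, ht, htpos⟩ := ((hev.filter_mono nhdsWithin_le_nhds).and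
    (self_mem_nhdsWithin : Set.Ioi (0:ℝ) ∈ 𝓝[>] 0)).exists
  by_contra hcon
  push Not at hcon
  set p := mkPt N y t with hp
  set e : EuclideanSpace ℝ (Fin N) := EuclideanSpace.single ⟨0, h0⟩ 1 with he
  have hmem : ∀ s : ℝ, p + s • e ∈ Hplus N h0 := by
    intro s
    have h1 : N - 1 ≠ 0 := by omega
    have : xN N h0 (p + s • e) = t := by
      simp [xN, hp, he, mkPt, h1]
    show 0 < xN N h0 _
    rw [this]; exact htpos
  have hder : ∀ s : ℝ, HasDerivAt (fun s : ℝ => u (p + s • e)) 0 s := by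
    intro s
    have h1 : HasDerivAt (fun s : ℝ => p + s • e) e s := by
      simpa using ((hasDerivAt_id s).smul_const e).const_add p
    have h2 := ((hu.differentiable (by simp)) (p + s • e)).hasFDerivAt.comp_hasDerivAt s h1
    have h3 := hcon _ (hmem s)
    unfold pd at h3
    rw [h3] at h2
    exact h2
  obtain ⟨R, hR⟩ := hc.isCompact.isBounded.subset_closedBall 0
  have hconst := is_const_of_deriv_eq_zero (fun s => (hder s).differentiableAt)
    (fun s => (hder s).deriv) 0 (|R| + ‖p‖ + 1)
  have hz : u (p + (|R| + ‖p‖ + 1) • e) = 0 := by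
    by_contra hne
    have h1 := hR (subset_tsupport u (Function.mem_support.2 hne))
    have h2 : ‖p + (|R| + ‖p‖ + 1) • e‖ ≤ R := by simpa using h1
    have h3 : ‖(|R| + ‖p‖ + 1) • e‖ = |R| + ‖p‖ + 1 := by
      rw [norm_smul, he, EuclideanSpace.norm_single, Real.norm_eq_abs, abs_of_pos (by positivity)]
      simp
    have h4 := norm_sub_le (p + (|R| + ‖p‖ + 1) • e) p
    rw [add_sub_cancel_left, h3] at h4
    have := le_abs_self R
    linarith
  simp only [zero_smul, add_zero] at hconst
  exact ht (hconst.trans hz)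

theorem stmt6 (N : ℕ) (hN : 3 ≤ N) (γ : ℝ) (hγ : 1 < γ)
    (ρ : ℝ → ℝ) (hρloc : LocallyIntegrableOn ρ (Set.Ici (0 : ℝ)))
    (hρnn : ∀ s : ℝ, 0 ≤ s → 0 ≤ ρ s)
    (hρ : ∀ s : ℝ, 0 ≤ s → (1 + s) ^ γ ≤ ρ s) :
    ∀ u : EuclideanSpace ℝ (Fin N) → ℝ,
      ContDiff ℝ (⊤ : ℕ∞) u → HasCompactSupport u →
      ¬ (∀ y : EuclideanSpace ℝ (Fin (N - 1)), u (bPt N y) = 0) →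
      sInf {E : ℝ | ∃ v : EuclideanSpace ℝ (Fin N) → ℝ,
          ContDiff ℝ (⊤ : ℕ∞) v ∧ HasCompactSupport v ∧
          (∫ y : EuclideanSpace ℝ (Fin (N - 1)), (v (bPt N y)) ^ 2) = 1 ∧
          E = ∫ x in Hplus N (by omega),
            ρ (xN N (by omega) x) * ‖gradient v x‖ ^ 2} *
        (∫ y : EuclideanSpace ℝ (Fin (N - 1)), (u (bPt N y)) ^ 2) <
      ∫ x in Hplus N (by omega),
        ρ (xN N (by omega) x) * ‖gradient u x‖ ^ 2 := by
  intro u hu hc hne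
  push Not at hne
  obtain ⟨y, hy⟩ := hne
  have h0 : 0 < N := by omega
  have hHm : MeasurableSet (Hplus N h0) :=
    measurableSet_lt measurable_const (xN_cont N h0).measurable
  have hHo : IsOpen (Hplus N h0) := isOpen_lt continuous_const (xN_cont N h0)
  have hbcont : Continuous (bPt N) :=
    (mkPt_cont_s6 N).comp (by fun_prop : Continuous fun y => (y, (0:ℝ)))
  set c := ∫ y : EuclideanSpace ℝ (Fin (N - 1)), (u (bPt N y)) ^ 2 with hcdef
  have hcpos : 0 < c := by
    refine Continuous.integral_pos_of_hasCompactSupport_nonneg_nonzero (x := y)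
      ((hu.continuous.comp hbcont).pow 2) ?_ (fun _ => sq_nonneg _) (pow_ne_zero 2 hy)
    obtain ⟨R, hR⟩ := hc.isCompact.isBounded.subset_closedBall 0
    refine HasCompactSupport.intro (isCompact_closedBall (0 : EuclideanSpace ℝ (Fin (N-1))) R) ?_
    intro z hz
    by_contra hne
    apply hz
    have h1 := hR (subset_tsupport u (Function.mem_support.2
      (fun h : u (bPt N z) = 0 => hne (by simp [h]))))
    have h2 : ‖bPt N z‖ ≤ R := by simpa using h1
    have h3 : ‖z‖ = ‖bPt N z‖ := by
      rw [EuclideanSpace.norm_eq, EuclideanSpace.norm_eq]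
      congr 1
      obtain ⟨m, rfl⟩ : ∃ m, N = m + 1 := ⟨N - 1, by omega⟩
      rw [Fin.sum_univ_castSucc]
      simp [bPt, mkPt]
    simpa [h3] using h2
  set q := pd N u ⟨0, h0⟩ with hq
  have hqc : Continuous q := pd_cont N u hu _
  have hqs : HasCompactSupport q := pd_supp N u hc _
  set G : EuclideanSpace ℝ (Fin N) → ℝ := fun x => ‖gradient u x‖ ^ 2 with hG
  have hGeq : G = fun x => ∑ i, (pd N u i x) ^ 2 := funext (norm_grad N u)
  have hGc : Continuous G := by
    rw [hGeq]
    exact continuous_finset_sum _ fun i _ => (pd_cont N u hu i).pow 2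
  have hGs : HasCompactSupport G := by
    obtain hfs := hc.fderiv (𝕜 := ℝ)
    refine hfs.mono ?_
    intro x hx hx2
    apply hx
    simp [G, gradient, hx2]
  have hi1 := integ N h0 ρ hρloc G hGc hGs
  have hi2 := integ N h0 ρ hρloc (fun x => q x ^ 2) (hqc.pow 2)
    (hqs.comp_left (g := fun t : ℝ => t ^ 2) (by simp))
  set A := ∫ x in Hplus N h0, ρ (xN N h0 x) * G x with hA
  set B := ∫ x in Hplus N h0, ρ (xN N h0 x) * q x ^ 2 with hB
  have hρpos : ∀ x ∈ Hplus N h0, 0 < ρ (xN N h0 x) := by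
    intro x hx
    have hx' : 0 < xN N h0 x := hx
    exact lt_of_lt_of_le (Real.rpow_pos_of_pos (by linarith) _) (hρ _ hx'.le)
  have hBpos : 0 < B := by
    rw [hB, setIntegral_pos_iff_support_of_nonneg_ae _ hi2]
    · obtain ⟨x, hx, hxq⟩ := exists_pd_ne N hN h0 u hu hc y hy
      refine lt_of_lt_of_le ?_ (measure_mono (?_ : {x | q x ≠ 0} ∩ Hplus N h0 ⊆ _))
      · exact ((hqc.isOpen_preimage {0}ᶜ isOpen_compl_singleton).inter hHo).measure_pos volume
          ⟨x, hxq, hx⟩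
      · rintro z ⟨hz, hzH⟩
        exact ⟨mul_ne_zero (hρpos z hzH).ne' (pow_ne_zero 2 hz), hzH⟩
    · filter_upwards [ae_restrict_mem hHm] with x hx
      exact mul_nonneg (hρpos x hx).le (sq_nonneg _)
  set a : ℝ := Real.sqrt (1 / (2 * c)) with ha
  have ha2 : a ^ 2 = 1 / (2 * c) := Real.sq_sqrt (by positivity)
  have hd : Differentiable ℝ u := hu.differentiable (by simp)
  have hgv : ∀ x, ‖gradient (fun x => a * u (LL N x)) x‖ ^ 2 =
      a ^ 2 * (G (LL N x) - 3 / 4 * q (LL N x) ^ 2) := by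
    intro x
    rw [norm_grad, hGeq]
    simp only [pd_comp N u hd]
    obtain ⟨m, rfl⟩ : ∃ m, N = m + 1 := ⟨N - 1, by omega⟩
    rw [Fin.sum_univ_succ, Fin.sum_univ_succ]
    have h1 : ∀ i : Fin m, (a * (dd (m+1) i.succ * pd (m+1) u i.succ (LL (m+1) x))) ^ 2 =
        a ^ 2 * (pd (m+1) u i.succ (LL (m+1) x)) ^ 2 := by
      intro i
      simp [dd]; ring
    simp only [h1, ← Finset.mul_sum]
    have h2 : dd (m+1) 0 = 1 / 2 := by simp [dd]
    have h3 : q (LL (m+1) x) = pd (m+1) u 0 (LL (m+1) x) := rfl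
    rw [h2, h3]
    ring
  have hE : ∫ x in Hplus N h0, ρ (xN N h0 x) * ‖gradient (fun x => a * u (LL N x)) x‖ ^ 2
      = (A - 3 / 4 * B) / c := by
    have hF : ∀ x, (Hplus N h0).indicator
        (fun x => ρ (xN N h0 x) * ‖gradient (fun x => a * u (LL N x)) x‖ ^ 2) x =
        (fun z => (Hplus N h0).indicator
          (fun z => a ^ 2 * (ρ (xN N h0 z) * G z - 3 / 4 * (ρ (xN N h0 z) * q z ^ 2))) z)
          (LL N x) := by
      intro x
      have hiff : LL N x ∈ Hplus N h0 ↔ x ∈ Hplus N h0 := by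
        simp only [Hplus, Set.mem_setOf_eq, xN_LL N hN h0]
      by_cases hx : x ∈ Hplus N h0
      · simp only [Set.indicator_of_mem hx, Set.indicator_of_mem (hiff.2 hx), hgv, xN_LL N hN h0]
        ring
      · simp only [Set.indicator_of_notMem hx, Set.indicator_of_notMem (mt hiff.1 hx)]
    rw [← integral_indicator hHm, integral_congr_ae (ae_of_all _ hF), integral_comp_LL N h0,
      integral_indicator hHm, integral_const_mul, integral_sub hi1 (hi2.const_mul _),
      integral_const_mul, ha2, ← hA, ← hB]
    field_simp
  have hmem : (A - 3 / 4 * B) / c ∈ {E : ℝ | ∃ v : EuclideanSpace ℝ (Fin N) → ℝ,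
          ContDiff ℝ (⊤ : ℕ∞) v ∧ HasCompactSupport v ∧
          (∫ y : EuclideanSpace ℝ (Fin (N - 1)), (v (bPt N y)) ^ 2) = 1 ∧
          E = ∫ x in Hplus N h0, ρ (xN N h0 x) * ‖gradient v x‖ ^ 2} := by
    refine ⟨fun x => a * u (LL N x), ?_, ?_, ?_, hE.symm⟩
    · exact contDiff_const.mul (hu.comp (LL N).contDiff)
    · exact (hc.comp_homeomorph (LLe N h0).toHomeomorph).mul_left (f := fun _ => a)
    · simp only [← bPt_LL N hN, mul_pow, integral_const_mul]
      rw [integral_comp_LL (N - 1) (by omega) (fun y => u (bPt N y) ^ 2), ← hcdef, ha2]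
      field_simp
  have hle := csInf_le (⟨0, by
    rintro E ⟨v, -, -, -, rfl⟩
    exact setIntegral_nonneg hHm fun x hx => mul_nonneg (hρpos x hx).le (sq_nonneg _)⟩) hmem
  calc _ ≤ (A - 3 / 4 * B) / c * c := mul_le_mul_of_nonneg_right hle hcpos.le
    _ = A - 3 / 4 * B := by field_simp
    _ < A := by linarith
end
end
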